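/- arXiv:1109.3596 — 7 statements merged into one kernel-verified Lean document; each statement's English description precedes it below -/
import Mathlib

section
/- Let n be an odd composite natural number. Then the number of Euler liars for n, i.e. units a of Z/nZ with a^((n-1)/2) ≡ (a/n) (mod n) where (a/n) denotes the Jacobi symbol, is exactly φ(n)/2 if and only if a^((n-1)/2) ≡ 1 (mod n) for every unit a of Z/nZ. -/
open NumberTheorySymbols

theorem Nat.ModEq.of_squarefree {n a b : ℕ} (hn : Squarefree n)
    (h : ∀ p, p.Prime → p ∣ n → a ≡ b [MOD p]) : a ≡ b [MOD n] := by
  rw [Nat.modEq_iff_dvd, Int.natCast_dvd, ← Nat.prod_primeFactors_of_squarefree hn]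
  refine Finset.prod_primes_dvd _ (fun p hp => (Nat.prime_of_mem_primeFactors hp).prime)
    fun p hp => ?_
  rw [← Int.natCast_dvd, ← Nat.modEq_iff_dvd]
  exact h p (Nat.prime_of_mem_primeFactors hp) (Nat.dvd_of_mem_primeFactors hp)

theorem jacobiSym.congr_of_modEq {a b n : ℕ} (h : a ≡ b [MOD n]) : J(a | n) = J(b | n) :=
  jacobiSym.mod_left' (by exact_mod_cast h)

theorem jacobiSym.coprime_of_eq_neg_one {a n : ℕ} (h : J(a | n) = -1) : a.Coprime n := by
  by_contra hc
  have hn : n ≠ 0 := by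
    rintro rfl
    simp at h
  have := (jacobiSym.eq_zero_iff (a := a) (b := n)).2 ⟨hn, by simpa using hc⟩
  omega

/-- A compatible choice of residues modulo coprime `m` and `k` multiplies the Jacobi symbols. -/
theorem jacobiSym.exists_modEq_and_modEq {m k : ℕ} (hm : m ≠ 0) (hk : k ≠ 0) (h : m.Coprime k)
    (a b : ℕ) : ∃ x : ℕ, x ≡ a [MOD m] ∧ x ≡ b [MOD k] ∧ J(x | m * k) = J(a | m) * J(b | k) := by
  obtain ⟨x, hx, hx'⟩ := Nat.chineseRemainder h a b
  exact ⟨x, hx, hx', by rw [jacobiSym.mul_right' _ hm hk, congr_of_modEq hx, congr_of_modEq hx']⟩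

theorem Squarefree.coprime_of_mul_left {m k : ℕ} (h : Squarefree (m * k)) : m.Coprime k :=
  (Nat.squarefree_mul_iff.1 h).1

theorem jacobiSym.exists_eq_neg_one {n : ℕ} (hn : n ≠ 1) (hodd : Odd n) (hsq : Squarefree n) :
    ∃ x : ℕ, J(x | n) = -1 := by
  obtain ⟨p, hp, k, rfl⟩ := Nat.exists_prime_and_dvd hn
  have : Fact p.Prime := ⟨hp⟩
  have hp2 : p ≠ 2 := by
    rintro rfl
    exact (Nat.not_even_iff_odd.2 hodd) (even_two_mul k)
  obtain ⟨c, hc⟩ := FiniteField.exists_nonsquare (F := ZMod p) (by rwa [ZMod.ringChar_zmod_n])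
  have hk : k ≠ 0 := by
    rintro rfl
    simp at hodd
  obtain ⟨x, -, -, hx⟩ := jacobiSym.exists_modEq_and_modEq hp.ne_zero hk
    hsq.coprime_of_mul_left c.val 1
  refine ⟨x, ?_⟩
  rw [hx, Nat.cast_one, jacobiSym.one_left, mul_one, ← legendreSym.to_jacobiSym,
    legendreSym.eq_neg_one_iff']
  simpa using hc

theorem ZMod.one_ne_neg_one {n : ℕ} (hn : 2 < n) : (1 : ZMod n) ≠ -1 := by
  have : Fact (2 < n) := ⟨hn⟩
  exact ZMod.neg_one_ne_one.symm

theorem one_add_pow_of_mul_self_eq_zero {R : Type*} [CommRing R] {k : R} (hk : k * k = 0) (j : ℕ) :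
    (1 + k) ^ j = 1 + j * k := by
  induction j with
  | zero => simp
  | succ j ih =>
    rw [pow_succ, ih]
    push_cast
    linear_combination (j : R) * hk

theorem squarefree_of_forall_units_pow_eq_one {n : ℕ} (hn : 1 < n)
    (h : ∀ a : (ZMod n)ˣ, (a : ZMod n) ^ (n - 1) = 1) : Squarefree n := by
  rw [Nat.squarefree_iff_prime_squarefree]
  rintro p hp ⟨k, hk⟩
  have hpos : 0 < p * k := by
    rcases Nat.eq_zero_or_pos (p * k) with h0 | h0
    · rw [mul_assoc, h0] at hk
      omega
    · exact h0
  have hsq : ((p * k : ℕ) : ZMod n) * ((p * k : ℕ) : ZMod n) = 0 := by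
    rw [← Nat.cast_mul, ZMod.natCast_eq_zero_iff]
    exact ⟨k, by rw [hk]; ring⟩
  generalize ht : ((p * k : ℕ) : ZMod n) = t at hsq
  have hu := h ⟨1 + t, 1 - t, by linear_combination -hsq, by linear_combination -hsq⟩
  rw [Units.val_mk, one_add_pow_of_mul_self_eq_zero hsq, Nat.cast_sub hn.le, ZMod.natCast_self] at hu
  have h0 : t = 0 := by linear_combination -hu
  rw [← ht, ZMod.natCast_eq_zero_iff] at h0
  have := Nat.le_of_dvd hpos h0
  have := hp.two_le
  nlinarith

/-- The Jacobi symbol modulo `n` as a homomorphism on the units of `ZMod n`. -/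
def jacobiHom (n : ℕ) [NeZero n] : (ZMod n)ˣ →* ℤ where
  toFun a := J(((a : ZMod n).val : ℤ) | n)
  map_one' := by
    rw [Units.val_one, ZMod.val_one_eq_one_mod, Int.natCast_mod, ← jacobiSym.mod_left,
      Nat.cast_one, jacobiSym.one_left]
  map_mul' a b := by
    rw [Units.val_mul, ZMod.val_mul, Int.natCast_mod, ← jacobiSym.mod_left, Nat.cast_mul,
      jacobiSym.mul_left]

/-- The group of Euler liars for `n`. -/
def eulerLiars (n : ℕ) [NeZero n] : Subgroup (ZMod n)ˣ :=
  ((powMonoidHom ((n - 1) / 2)).comp (Units.coeHom (ZMod n))).eqLocus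
    ((Int.castRingHom (ZMod n) : ℤ →* ZMod n).comp (jacobiHom n))

section

variable {n : ℕ} [NeZero n]

theorem mem_eulerLiars {a : (ZMod n)ˣ} : a ∈ eulerLiars n ↔
    (a : ZMod n) ^ ((n - 1) / 2) = ((jacobiHom n a : ℤ) : ZMod n) :=
  Iff.rfl

theorem jacobiHom_unitOfCoprime {x : ℕ} (hx : x.Coprime n) :
    jacobiHom n (ZMod.unitOfCoprime x hx) = J(x | n) := by
  change J(((ZMod.unitOfCoprime x hx : ZMod n).val : ℤ) | n) = _
  rw [ZMod.coe_unitOfCoprime, ZMod.val_natCast, Int.natCast_mod, ← jacobiSym.mod_left]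

theorem jacobiHom_eq_one_or_neg_one (a : (ZMod n)ˣ) : jacobiHom n a = 1 ∨ jacobiHom n a = -1 :=
  jacobiSym.eq_one_or_neg_one (by exact_mod_cast ZMod.val_coe_unit_coprime a)

theorem card_eulerLiars_eq_iff (hn : 2 < n) :
    Nat.card (eulerLiars n) = n.totient / 2 ↔ (eulerLiars n).index = 2 := by
  have hmul := (eulerLiars n).card_mul_index
  have hpos : 0 < Nat.card (eulerLiars n) := Nat.card_pos
  obtain ⟨t, ht⟩ := Nat.totient_even hn
  rw [Nat.card_eq_fintype_card (α := (ZMod n)ˣ), ZMod.card_units_eq_totient] at hmul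
  constructor
  · intro h
    refine Nat.eq_of_mul_eq_mul_left hpos ?_
    omega
  · intro h
    rw [h] at hmul
    omega

theorem not_mem_eulerLiars {d x : ℕ} (hdn : d ∣ n) (hd : 2 < d) (hx : x ≡ 1 [MOD d])
    (hJ : J(x | n) = -1) :
    ZMod.unitOfCoprime x (jacobiSym.coprime_of_eq_neg_one hJ) ∉ eulerLiars n := by
  intro h
  have h' := congr_arg (ZMod.castHom hdn (ZMod d)) (mem_eulerLiars.1 h)
  rw [jacobiHom_unitOfCoprime, hJ, ZMod.coe_unitOfCoprime, map_pow, map_natCast, map_intCast,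
    (ZMod.natCast_eq_natCast_iff _ _ _).2 hx] at h'
  exact ZMod.one_ne_neg_one hd (by simpa using h')

theorem index_eulerLiars_eq_two (hn : 2 < n) (hodd : Odd n)
    (h : ∀ a : (ZMod n)ˣ, (a : ZMod n) ^ ((n - 1) / 2) = 1) : (eulerLiars n).index = 2 := by
  have hn1 : (n - 1) / 2 * 2 = n - 1 := by
    obtain ⟨m, rfl⟩ := hodd
    omega
  have hsq : Squarefree n := squarefree_of_forall_units_pow_eq_one (by omega) fun a => by
    rw [← hn1, pow_mul, h, one_pow]
  obtain ⟨x, hx⟩ := jacobiSym.exists_eq_neg_one (by omega) hodd hsq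
  have hmem (b : (ZMod n)ˣ) (hb : jacobiHom n b = 1) : b ∈ eulerLiars n := by
    rw [mem_eulerLiars, h, hb, Int.cast_one]
  rw [Subgroup.index_eq_two_iff_exists_notMem_and]
  have hcop := jacobiSym.coprime_of_eq_neg_one hx
  have hxJ : jacobiHom n (ZMod.unitOfCoprime x hcop) = -1 := by
    rw [jacobiHom_unitOfCoprime, hx]
  refine ⟨ZMod.unitOfCoprime x hcop, fun hx' => ?_, fun b => ?_⟩
  · rw [mem_eulerLiars, h, hxJ] at hx'
    exact ZMod.one_ne_neg_one hn (by simpa using hx')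
  · rcases jacobiHom_eq_one_or_neg_one b with hb | hb
    · exact Or.inr (hmem b hb)
    · exact Or.inl (hmem _ (by rw [map_mul, hb, hxJ]; norm_num))

theorem pow_eq_one_of_index_eulerLiars (hn : n ≠ 1) (hodd : Odd n) (hcomp : ¬ n.Prime)
    (h : (eulerLiars n).index = 2) (a : (ZMod n)ˣ) : (a : ZMod n) ^ ((n - 1) / 2) = 1 := by
  have hn1 : 2 * ((n - 1) / 2) = n - 1 := by
    obtain ⟨m, rfl⟩ := hodd
    omega
  have hn0 : n ≠ 0 := NeZero.ne n
  have hcarm (b : (ZMod n)ˣ) : (b : ZMod n) ^ (n - 1) = 1 := by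
    have hb := mem_eulerLiars.1 (Subgroup.mul_self_mem_of_index_two h b)
    rw [map_mul, Units.val_mul, ← pow_two, ← pow_mul, hn1] at hb
    rcases jacobiHom_eq_one_or_neg_one b with hb' | hb' <;> simpa [hb'] using hb
  have hsq : Squarefree n := squarefree_of_forall_units_pow_eq_one (by omega) hcarm
  by_contra hne
  obtain ⟨p, hp, hpn, hpa⟩ :
      ∃ p, p.Prime ∧ p ∣ n ∧ ¬ (a : ZMod n).val ^ ((n - 1) / 2) ≡ 1 [MOD p] := by
    by_contra! hall
    have := (ZMod.natCast_eq_natCast_iff _ _ _).2 (Nat.ModEq.of_squarefree hsq hall)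
    simp at this
    exact hne this
  have : Fact p.Prime := ⟨hp⟩
  have hJ : J(((a : ZMod n).val : ℤ) | p) = -1 := by
    rw [← jacobiSym.legendreSym.to_jacobiSym, legendreSym.eq_neg_one_iff']
    rintro ⟨c, hc⟩
    have hcop := (ZMod.val_coe_unit_coprime a).coprime_dvd_right hpn
    have hc0 : c ≠ 0 := by
      rintro rfl
      rw [mul_zero, ZMod.natCast_eq_zero_iff] at hc
      exact hp.one_lt.ne' (Nat.eq_one_of_dvd_coprimes hcop hc dvd_rfl)
    obtain ⟨u, hu⟩ := ZMod.unitsMap_surjective hpn (Units.mk0 c hc0)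
    have hcu : ZMod.castHom hpn (ZMod p) u = c := by
      simpa [ZMod.unitsMap_def] using congr_arg Units.val hu
    apply hpa
    rw [← ZMod.natCast_eq_natCast_iff, Nat.cast_pow, hc, ← pow_two, ← pow_mul, hn1, ← hcu,
      ← map_pow, hcarm, map_one, Nat.cast_one]
  obtain ⟨q, hq⟩ := hpn
  have hq0 : q ≠ 0 := by
    rintro rfl
    exact hn0 hq
  have hq1 : q ≠ 1 := by
    rintro rfl
    exact hcomp (by rwa [hq, mul_one])
  obtain ⟨hpodd, hqodd⟩ := Nat.odd_mul.1 (hq ▸ hodd)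
  have hp2 : 2 < p := by
    have := hp.two_le
    obtain ⟨m, rfl⟩ := hpodd
    omega
  have hq2 : 2 < q := by
    obtain ⟨m, rfl⟩ := hqodd
    omega
  have hsq' := hq ▸ hsq
  have hpq : p.Coprime q := hsq'.coprime_of_mul_left
  obtain ⟨y₀, hy₀⟩ := jacobiSym.exists_eq_neg_one hq1 hqodd
    (hsq'.squarefree_of_dvd (dvd_mul_left q p))
  obtain ⟨x, hxp, hxq, hxJ⟩ :=
    jacobiSym.exists_modEq_and_modEq hp.ne_zero hq0 hpq (a : ZMod n).val 1
  obtain ⟨y, hyp, hyq, hyJ⟩ := jacobiSym.exists_modEq_and_modEq hp.ne_zero hq0 hpq 1 y₀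
  rw [← hq, hJ, Nat.cast_one, jacobiSym.one_left, mul_one] at hxJ
  rw [← hq, hy₀, Nat.cast_one, jacobiSym.one_left, one_mul] at hyJ
  have hxL := not_mem_eulerLiars ⟨p, by rw [hq, mul_comm]⟩ hq2 hxq hxJ
  have hyL := not_mem_eulerLiars ⟨q, hq⟩ hp2 hyp hyJ
  have hxy :=
    mem_eulerLiars.1 ((Subgroup.mul_mem_iff_of_index_two h).2 (iff_of_false hxL hyL))
  rw [map_mul, jacobiHom_unitOfCoprime, jacobiHom_unitOfCoprime, hxJ, hyJ, Units.val_mul,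
    ZMod.coe_unitOfCoprime, ZMod.coe_unitOfCoprime] at hxy
  have hmod : (x * y) ^ ((n - 1) / 2) ≡ 1 [MOD n] := by
    rw [← ZMod.natCast_eq_natCast_iff]
    simpa using hxy
  refine hpa ((Nat.ModEq.symm ?_).trans (hmod.of_dvd ⟨q, hq⟩))
  simpa using (hxp.mul hyp).pow ((n - 1) / 2)

end


/-- An odd composite `n` is an Euler pseudoprime for exactly one half of the
bases in `U(ℤ/nℤ)` if and only if `a ^ ((n-1)/2) ≡ 1 (mod n)` for every unit
`a` of `ℤ/nℤ`. Here the Euler-liar condition for a unit `a` is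
`a ^ ((n-1)/2) ≡ (a/n) (mod n)` with `(a/n)` the Jacobi symbol. -/
theorem stmt_0 (n : ℕ) (hn : 1 < n) (hodd : Odd n) (hcomp : ¬ n.Prime) :
    Nat.card {a : (ZMod n)ˣ //
        ((a : ZMod n) ^ ((n - 1) / 2) = ((jacobiSym ((a : ZMod n).val : ℤ) n : ℤ) : ZMod n))}
      = n.totient / 2
    ↔ ∀ a : (ZMod n)ˣ, (a : ZMod n) ^ ((n - 1) / 2) = 1 := by
  have : NeZero n := ⟨by omega⟩
  have hn2 : 2 < n := by
    obtain ⟨m, rfl⟩ := hodd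
    omega
  exact (card_eulerLiars_eq_iff hn2).trans
    ⟨pow_eq_one_of_index_eulerLiars hn.ne' hodd hcomp, index_eulerLiars_eq_two hn2 hodd⟩
end

section
/- Let n > 2 be an odd natural number. Then for every integer a, a^(n-1) is not congruent to -1 modulo n. -/
/-- A positive integer all of whose prime factors are `1` modulo `m` is itself `1` modulo `m`. -/
theorem Nat.modEq_one_of_forall_prime_dvd {m n : ℕ} (hn : n ≠ 0)
    (h : ∀ p, p.Prime → p ∣ n → p ≡ 1 [MOD m]) : n ≡ 1 [MOD m] := by
  induction n using induction_on_primes with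
  | zero => exact absurd rfl hn
  | one => rfl
  | prime_mul p k hp ih =>
    have hk : k ≡ 1 [MOD m] := ih (right_ne_zero_of_mul hn)
      fun q hq hqk => h q hq (hqk.mul_left p)
    simpa using (h p hp (dvd_mul_right p k)).mul hk

/-- If `-1` is a `2 ^ k`-th power modulo an odd prime `p`, then `p` is `1` modulo `2 ^ (k + 1)`. -/
theorem Nat.Prime.modEq_one_of_pow_two_pow_eq_neg_one {p k : ℕ} (hp : p.Prime) (hp2 : p ≠ 2)
    {b : ZMod p} (hb : b ^ 2 ^ k = -1) : p ≡ 1 [MOD 2 ^ (k + 1)] := by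
  have : Fact p.Prime := ⟨hp⟩
  have : Fact (2 < p) := ⟨lt_of_le_of_ne hp.two_le hp2.symm⟩
  have hord : orderOf b = 2 ^ (k + 1) := by
    apply orderOf_eq_prime_pow
    · rw [hb]
      exact ZMod.neg_one_ne_one
    · rw [pow_succ, pow_mul, hb, neg_one_sq]
  have hb0 : b ≠ 0 := by
    rintro rfl
    rw [zero_pow (by positivity)] at hb
    exact neg_ne_zero.mpr one_ne_zero hb.symm
  have hdvd : 2 ^ (k + 1) ∣ p - 1 := hord ▸ ZMod.orderOf_dvd_card_sub_one hb0
  exact ((Nat.modEq_iff_dvd' hp.one_le).mpr hdvd).symm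

/-- Let `n > 2` be an odd natural number. Then for any integer `a`,
`a ^ (n - 1)` is not congruent to `-1` modulo `n`. -/
theorem stmt_1 (n : ℕ) (hn : 2 < n) (hodd : Odd n) (a : ℤ) :
    ¬ ((a : ZMod n) ^ (n - 1) = -1) := by
  intro h
  obtain ⟨k, m, hm, hkm⟩ := Nat.exists_eq_two_pow_mul_odd (n := n - 1) (by omega)
  have hmod : n ≡ 1 [MOD 2 ^ (k + 1)] := by
    refine Nat.modEq_one_of_forall_prime_dvd (by omega) fun p hp hpn => ?_
    have hp2 : p ≠ 2 := by
      rintro rfl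
      exact Nat.not_even_iff_odd.mpr hodd (even_iff_two_dvd.mpr hpn)
    have hpow : (a : ZMod p) ^ (n - 1) = -1 := by
      simpa only [map_pow, map_intCast, map_neg, map_one] using
        congrArg (ZMod.castHom hpn (ZMod p)) h
    refine hp.modEq_one_of_pow_two_pow_eq_neg_one hp2 (b := (a : ZMod p) ^ m) ?_
    rw [← pow_mul, mul_comm, ← hkm, hpow]
  have hdvd : 2 ^ (k + 1) ∣ n - 1 := (Nat.modEq_iff_dvd' (by omega)).mp hmod.symm
  rw [hkm, pow_succ] at hdvd
  exact Nat.not_even_iff_odd.mpr hm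
    (even_iff_two_dvd.mpr (Nat.dvd_of_mul_dvd_mul_left (by positivity) hdvd))
end

section
/- Let n be an odd composite natural number and let B = {a ∈ U(Z/nZ) : a^((n-1)/2) ≡ 1 (mod n) or a^((n-1)/2) ≡ -1 (mod n)}. If |B| ≥ φ(n)/2, then n is a Carmichael number, i.e. a^(n-1) ≡ 1 (mod n) for every unit a of Z/nZ. -/
/-- If every unit modulo `r * s` has `k`-th power `±1`, with `r`, `s` coprime and `2 < s`,
then every unit modulo `r * s` has `k`-th power `1` modulo `r`. -/
theorem natCast_pow_eq_one_of_forall_pow_eq_one_or_neg_one {r s k : ℕ} (hrs : r.Coprime s)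
    (hs : 2 < s)
    (H : ∀ x : ℕ, x.Coprime (r * s) →
      (x : ZMod (r * s)) ^ k = 1 ∨ (x : ZMod (r * s)) ^ k = -1)
    (u : ℕ) (hu : u.Coprime (r * s)) : (u : ZMod r) ^ k = 1 := by
  obtain ⟨x, hxr, hxs⟩ := Nat.chineseRemainder hrs u 1
  have hx : x.Coprime (r * s) := by
    refine Nat.Coprime.mul_right ?_ ?_
    · rw [Nat.Coprime, hxr.gcd_eq]
      exact hu.coprime_mul_right_right
    · rw [Nat.Coprime, hxs.gcd_eq, Nat.gcd_one_left]
  have hur : (x : ZMod r) = u := (ZMod.natCast_eq_natCast_iff _ _ _).2 hxr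
  have h1s : (x : ZMod s) = 1 := by
    simpa using (ZMod.natCast_eq_natCast_iff _ _ _).2 hxs
  have : Fact (2 < s) := ⟨hs⟩
  rcases H x hx with h | h
  · have := congrArg (ZMod.castHom (Dvd.intro s rfl : r ∣ r * s) (ZMod r)) h
    rwa [map_pow, map_natCast, map_one, hur] at this
  · have := congrArg (ZMod.castHom (Dvd.intro_left r rfl : s ∣ r * s) (ZMod s)) h
    rw [map_pow, map_natCast, map_neg, map_one, h1s, one_pow] at this
    exact absurd this.symm ZMod.neg_one_ne_one

/-- A subgroup of a finite group with at least half of the elements contains all squares. -/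
theorem Subgroup.sq_mem_of_card_le_two_mul_card {G : Type*} [Group G] [Finite G]
    (B : Subgroup G) (h : Nat.card G ≤ 2 * Nat.card B) (a : G) : a ^ 2 ∈ B := by
  have hle : B.index ≤ 2 := by
    have hpos : 0 < Nat.card B := Nat.card_pos
    have := B.card_mul_index
    nlinarith
  have hne : B.index ≠ 0 := Subgroup.index_ne_zero_of_finite
  have hcases : B.index = 1 ∨ B.index = 2 := by omega
  rcases hcases with h1 | h2
  · rw [Subgroup.index_eq_one.1 h1]
    exact Subgroup.mem_top _
  · exact Subgroup.sq_mem_of_index_two h2 a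

/-- The units whose `m`-th power is `±1` form a subgroup. -/
def unitsPowEqOneOrNegOne (R : Type*) [CommRing R] (m : ℕ) : Subgroup Rˣ where
  carrier := {a | (a : R) ^ m = 1 ∨ (a : R) ^ m = -1}
  one_mem' := by simp
  mul_mem' := by
    rintro a b (ha | ha) (hb | hb) <;> simp [mul_pow, ha, hb]
  inv_mem' := by
    rintro a (ha | ha)
    · left
      have : a ^ m = 1 := Units.ext (by simpa using ha)
      rw [← Units.val_pow_eq_pow_val, inv_pow, this]
      simp
    · right
      have : a ^ m = -1 := Units.ext (by simpa using ha)
      rw [← Units.val_pow_eq_pow_val, inv_pow, this]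
      simp

/-- If `n` is odd and every unit modulo `n` has `(n - 1)`-st power `±1`, then `n` is
squarefree. -/
theorem squarefree_of_forall_units_pow_eq_one_or_neg_one {n : ℕ} (hn : 1 < n) (hodd : Odd n)
    (H : ∀ a : (ZMod n)ˣ, (a : ZMod n) ^ (n - 1) = 1 ∨ (a : ZMod n) ^ (n - 1) = -1) :
    Squarefree n := by
  have : NeZero n := ⟨by omega⟩
  rw [Nat.squarefree_iff_prime_squarefree]
  intro p hp hpn
  have hdvd : p ∣ n := (Dvd.intro p rfl).trans hpn
  have : Fact p.Prime := ⟨hp⟩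
  have hcard : p ∣ Nat.card (ZMod n)ˣ := by
    rw [Nat.card_eq_fintype_card, ZMod.card_units_eq_totient]
    refine dvd_trans ?_ (Nat.totient_dvd_of_dvd hpn)
    rw [Nat.totient_mul_of_prime_of_dvd hp dvd_rfl]
    exact Dvd.intro _ rfl
  obtain ⟨g, hg⟩ := exists_prime_orderOf_dvd_card' p hcard
  have hg2 : g ^ (2 * (n - 1)) = 1 := by
    apply Units.ext
    rw [Units.val_pow_eq_pow_val, mul_comm, pow_mul]
    rcases H g with h | h <;> simp [h]
  have hpd : p ∣ 2 * (n - 1) := hg ▸ orderOf_dvd_of_pow_eq_one hg2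
  rcases hp.dvd_mul.1 hpd with h | h
  · have h2 : p = 2 := (Nat.prime_dvd_prime_iff_eq hp Nat.prime_two).1 h
    subst h2
    exact (Nat.not_even_iff_odd.2 hodd) (even_iff_two_dvd.2 hdvd)
  · have := Nat.dvd_sub hdvd h
    rw [Nat.sub_sub_self hn.le] at this
    exact hp.one_lt.ne' (Nat.dvd_one.1 this)


/-- Let `n` be an odd composite number and
`B = {a ∈ U(ℤ/nℤ) : a ^ ((n-1)/2) ≡ ±1 (mod n)}`. If `|B| ≥ φ(n)/2`, then `n`
is a Carmichael number, i.e. `a ^ (n-1) ≡ 1 (mod n)` for every unit `a`. -/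
theorem stmt_2 (n : ℕ) (hn : 1 < n) (hodd : Odd n) (hcomp : ¬ n.Prime)
    (hB : n.totient / 2 ≤ Nat.card {a : (ZMod n)ˣ //
        (a : ZMod n) ^ ((n - 1) / 2) = 1 ∨ (a : ZMod n) ^ ((n - 1) / 2) = -1}) :
    ∀ a : (ZMod n)ˣ, (a : ZMod n) ^ (n - 1) = 1 := by
  have : NeZero n := ⟨by omega⟩
  have hn2 : 2 < n := by
    obtain ⟨m, rfl⟩ := hodd
    omega
  have hm : (n - 1) / 2 * 2 = n - 1 := by
    obtain ⟨m, rfl⟩ := hodd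
    omega
  have hpm : ∀ a : (ZMod n)ˣ, (a : ZMod n) ^ (n - 1) = 1 ∨ (a : ZMod n) ^ (n - 1) = -1 := by
    intro a
    have hcard : Nat.card (ZMod n)ˣ ≤
        2 * Nat.card (unitsPowEqOneOrNegOne (ZMod n) ((n - 1) / 2)) := by
      rw [Nat.card_eq_fintype_card, ZMod.card_units_eq_totient]
      have h2 := Nat.two_mul_div_two_of_even (Nat.totient_even hn2)
      have hB' : n.totient / 2 ≤
        Nat.card (unitsPowEqOneOrNegOne (ZMod n) ((n - 1) / 2)) := hB
      omega
    have h : ((a ^ 2 : (ZMod n)ˣ) : ZMod n) ^ ((n - 1) / 2) = 1 ∨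
        ((a ^ 2 : (ZMod n)ˣ) : ZMod n) ^ ((n - 1) / 2) = -1 :=
      Subgroup.sq_mem_of_card_le_two_mul_card _ hcard a
    rwa [Units.val_pow_eq_pow_val, ← pow_mul, mul_comm, hm] at h
  have hsq := squarefree_of_forall_units_pow_eq_one_or_neg_one hn hodd hpm
  obtain ⟨r, s, hr, hs, rfl⟩ : ∃ r s, 1 < r ∧ 1 < s ∧ n = r * s := by
    obtain ⟨s, hs⟩ := Nat.minFac_dvd n
    have hp := Nat.minFac_prime hn.ne'
    refine ⟨n.minFac, s, hp.one_lt, ?_, hs⟩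
    by_contra hle
    interval_cases s
    · omega
    · rw [mul_one] at hs
      exact hcomp (hs ▸ hp)
  have hrs : r.Coprime s := Nat.coprime_of_squarefree_mul hsq
  obtain ⟨hrodd, hsodd⟩ := Nat.odd_mul.1 hodd
  have hr2 : 2 < r := by
    obtain ⟨m, rfl⟩ := hrodd
    omega
  have hs2 : 2 < s := by
    obtain ⟨m, rfl⟩ := hsodd
    omega
  have H : ∀ x : ℕ, x.Coprime (r * s) → (x : ZMod (r * s)) ^ (r * s - 1) = 1 ∨
      (x : ZMod (r * s)) ^ (r * s - 1) = -1 := fun x hx => by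
    simpa using hpm (ZMod.unitOfCoprime x hx)
  intro a
  set u := (a : ZMod (r * s)).val with hu
  have hucop : u.Coprime (r * s) := ZMod.val_coe_unit_coprime a
  have hau : (a : ZMod (r * s)) = u := (ZMod.natCast_zmod_val _).symm
  have h1 : (u : ZMod r) ^ (r * s - 1) = 1 :=
    natCast_pow_eq_one_of_forall_pow_eq_one_or_neg_one hrs hs2 H u hucop
  have h2 : (u : ZMod s) ^ (r * s - 1) = 1 := by
    exact natCast_pow_eq_one_of_forall_pow_eq_one_or_neg_one (k := r * s - 1) hrs.symm hr2
      (by rwa [mul_comm s r]) u (by rwa [mul_comm s r])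
  have e1 : u ^ (r * s - 1) ≡ 1 [MOD r] :=
    (ZMod.natCast_eq_natCast_iff _ _ _).1 (by push_cast; exact h1)
  have e2 : u ^ (r * s - 1) ≡ 1 [MOD s] :=
    (ZMod.natCast_eq_natCast_iff _ _ _).1 (by push_cast; exact h2)
  have e := (ZMod.natCast_eq_natCast_iff _ _ _).2
    ((Nat.modEq_and_modEq_iff_modEq_mul hrs).1 ⟨e1, e2⟩)
  rw [hau]
  exact_mod_cast e
end

section
/- Let n > 2 be an odd natural number that is not a perfect square. Then the set P_n = {a ∈ U(Z/nZ) : (a/n) = 1} and the set N_n = {a ∈ U(Z/nZ) : (a/n) = -1} both have cardinality φ(n)/2. -/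
theorem exists_prime_odd_factorization {n : ℕ} (hn : n ≠ 0) (hsq : ¬ ∃ k : ℕ, n = k ^ 2) :
    ∃ p : ℕ, p.Prime ∧ Odd (n.factorization p) := by
  by_contra! h
  refine hsq ⟨n.factorization.prod fun p e => p ^ (e / 2), ?_⟩
  conv_lhs => rw [← Nat.prod_factorization_pow_eq_self hn]
  rw [Finsupp.prod, Finsupp.prod, ← Finset.prod_pow]
  refine Finset.prod_congr rfl fun p hp => ?_
  have he := Nat.not_odd_iff_even.mp (h p (Nat.prime_of_mem_primeFactors hp))
  rw [← pow_mul, Nat.div_mul_cancel he.two_dvd]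

theorem exists_jacobiSym_eq_neg_one {n : ℕ} (hodd : Odd n) (hsq : ¬ ∃ k : ℕ, n = k ^ 2) :
    ∃ a : ℕ, jacobiSym a n = -1 := by
  have hn0 : n ≠ 0 := hodd.pos.ne'
  obtain ⟨p, hp, he⟩ := exists_prime_odd_factorization hn0 hsq
  have : Fact p.Prime := ⟨hp⟩
  have hpn : p ∣ n := Nat.dvd_of_factorization_pos he.pos.ne'
  have hp2 : ringChar (ZMod p) ≠ 2 := by
    rw [ZMod.ringChar_zmod_n]
    rintro rfl
    exact Nat.not_odd_iff_even.mpr (even_iff_two_dvd.mpr hpn) hodd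
  obtain ⟨g, hg⟩ := FiniteField.exists_nonsquare hp2
  obtain ⟨a, ha1, ha2⟩ := Nat.chineseRemainder (Nat.coprime_ordCompl hp hn0) g.val 1
  refine ⟨a, ?_⟩
  have hap : jacobiSym a p = -1 := by
    rw [← jacobiSym.legendreSym.to_jacobiSym, legendreSym.eq_neg_one_iff']
    rw [(ZMod.natCast_eq_natCast_iff _ _ _).mpr ha1]
    simpa using hg
  have ham : jacobiSym a (ordCompl[p] n) = 1 := by
    rw [jacobiSym.mod_left' (a₂ := 1), jacobiSym.one_left]
    exact_mod_cast ha2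
  rw [← Nat.ordProj_mul_ordCompl_eq_self n p,
    jacobiSym.mul_right' _ (pow_ne_zero _ hp.ne_zero) (Nat.ordCompl_pos p hn0).ne',
    jacobiSym.pow_right, hap, ham, he.neg_one_pow, mul_one]

theorem jacobiSym_val_mul {n : ℕ} (a b : ZMod n) :
    jacobiSym ((a * b).val : ℤ) n = jacobiSym (a.val : ℤ) n * jacobiSym (b.val : ℤ) n := by
  rw [ZMod.val_mul, ← jacobiSym.mul_left]
  push_cast
  exact (jacobiSym.mod_left _ _).symm

theorem exists_unit_jacobiSym_eq_neg_one {n : ℕ} (hodd : Odd n) (hsq : ¬ ∃ k : ℕ, n = k ^ 2) :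
    ∃ u : (ZMod n)ˣ, jacobiSym ((u : ZMod n).val : ℤ) n = -1 := by
  have : NeZero n := ⟨hodd.pos.ne'⟩
  obtain ⟨a, ha⟩ := exists_jacobiSym_eq_neg_one hodd hsq
  have hco : a.Coprime n := by
    by_contra h
    have h0 : jacobiSym a n = 0 := jacobiSym.eq_zero_iff_not_coprime.mpr (by simpa using h)
    rw [h0] at ha
    norm_num at ha
  refine ⟨ZMod.unitOfCoprime a hco, ?_⟩
  rw [ZMod.coe_unitOfCoprime, ZMod.val_natCast, Int.natCast_mod, ← jacobiSym.mod_left, ha]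

/-- Let `n > 2` be an odd natural number that is not a perfect square. Then
`P_n = {a ∈ U(ℤ/nℤ) : (a/n) = 1}` and `N_n = {a ∈ U(ℤ/nℤ) : (a/n) = -1}`
both have cardinality `φ(n)/2`, where `(a/n)` is the Jacobi symbol. -/
theorem stmt_3 (n : ℕ) (hn : 2 < n) (hodd : Odd n) (hsq : ¬ ∃ k : ℕ, n = k ^ 2) :
    Nat.card {a : (ZMod n)ˣ // jacobiSym ((a : ZMod n).val : ℤ) n = 1} = n.totient / 2 ∧
    Nat.card {a : (ZMod n)ˣ // jacobiSym ((a : ZMod n).val : ℤ) n = -1} = n.totient / 2 := by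
  have : NeZero n := ⟨by omega⟩
  obtain ⟨u, hu⟩ := exists_unit_jacobiSym_eq_neg_one hodd hsq
  have heq : Nat.card {a : (ZMod n)ˣ // jacobiSym ((a : ZMod n).val : ℤ) n = 1} =
      Nat.card {a : (ZMod n)ˣ // jacobiSym ((a : ZMod n).val : ℤ) n = -1} := by
    refine Nat.card_congr ((Equiv.mulLeft u).subtypeEquiv fun a => ?_)
    rw [Equiv.coe_mulLeft, Units.val_mul, jacobiSym_val_mul, hu]
    omega
  have hiff (a : (ZMod n)ˣ) : jacobiSym ((a : ZMod n).val : ℤ) n = -1 ↔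
      ¬ jacobiSym ((a : ZMod n).val : ℤ) n = 1 := by
    have h := jacobiSym.eq_one_or_neg_one (a := ((a : ZMod n).val : ℤ)) (b := n)
      ((Int.gcd_natCast_natCast _ _).trans (ZMod.val_coe_unit_coprime a))
    omega
  have hsum : Nat.card {a : (ZMod n)ˣ // jacobiSym ((a : ZMod n).val : ℤ) n = 1} +
      Nat.card {a : (ZMod n)ˣ // jacobiSym ((a : ZMod n).val : ℤ) n = -1} = n.totient := by
    rw [← ZMod.card_units_eq_totient n, ← Nat.card_eq_fintype_card, ← Nat.card_sum,
      Nat.card_congr ((Equiv.sumCongr (Equiv.refl _) (Equiv.subtypeEquivRight hiff)).trans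
        (Equiv.sumCompl _))]
  omega
end

section
/- Let n > 2 be an odd natural number that is not a perfect square. Then there exists an integer x coprime to n such that the Jacobi symbol (x/n) equals -1. -/
/-- A natural number that is not a perfect square has a prime divisor of odd multiplicity. -/
theorem Nat.exists_prime_odd_pow_mul_of_not_sq {n : ℕ} (hn : n ≠ 0)
    (hsq : ¬ ∃ k : ℕ, n = k ^ 2) :
    ∃ p e m : ℕ, p.Prime ∧ Odd e ∧ ¬ p ∣ m ∧ n = p ^ e * m := by
  obtain ⟨a, b, hab, ha⟩ := Nat.sq_mul_squarefree n
  have ha1 : a ≠ 1 := by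
    rintro rfl
    exact hsq ⟨b, by rw [← hab, mul_one]⟩
  obtain ⟨p, hp, c, rfl⟩ := Nat.exists_prime_and_dvd ha1
  have hb : b ≠ 0 := by
    rintro rfl
    exact hn (by rw [← hab]; ring)
  obtain ⟨k, d, hd, rfl⟩ := Nat.exists_eq_pow_mul_and_not_dvd hb p hp.ne_one
  refine ⟨p, 2 * k + 1, d ^ 2 * c, hp, odd_two_mul_add_one k, ?_, ?_⟩
  · intro h
    rcases hp.dvd_mul.mp h with h | ⟨f, rfl⟩
    · exact hd (hp.dvd_of_dvd_pow h)
    · exact hp.ne_one (Nat.isUnit_iff.mp (ha p ⟨f, by ring⟩))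
  · rw [← hab]
    ring

/-- For every odd prime `p` there is a natural number with Jacobi symbol `-1` modulo `p`. -/
theorem jacobiSym.exists_eq_neg_one_of_prime {p : ℕ} (hp : p.Prime) (hp2 : p ≠ 2) :
    ∃ g : ℕ, jacobiSym g p = -1 := by
  have : Fact p.Prime := ⟨hp⟩
  obtain ⟨a, ha⟩ := FiniteField.exists_nonsquare (F := ZMod p) (by rwa [ZMod.ringChar_zmod_n])
  refine ⟨a.val, ZMod.nonsquare_iff_jacobiSym_eq_neg_one.mpr ?_⟩
  simpa using ha

/-- Let `n > 2` be an odd natural number that is not a perfect square. Then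
there exists an integer `x` coprime to `n` with Jacobi symbol `(x/n) = -1`. -/
theorem stmt_4 (n : ℕ) (hn : 2 < n) (hodd : Odd n) (hsq : ¬ ∃ k : ℕ, n = k ^ 2) :
    ∃ x : ℤ, Int.gcd x n = 1 ∧ jacobiSym x n = -1 := by
  have hn0 : n ≠ 0 := by lia
  obtain ⟨p, e, m, hp, he, hpm, hnpm⟩ := Nat.exists_prime_odd_pow_mul_of_not_sq hn0 hsq
  have hp2 : p ≠ 2 := by
    rintro rfl
    have h2 : 2 ∣ n := hnpm ▸ (dvd_pow_self 2 he.pos.ne').mul_right m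
    exact hodd.not_two_dvd_nat h2
  have hm : m ≠ 0 := by
    rintro rfl
    exact hpm (dvd_zero p)
  obtain ⟨g, hg⟩ := jacobiSym.exists_eq_neg_one_of_prime hp hp2
  obtain ⟨x, hxp, hxm⟩ := Nat.chineseRemainder ((hp.coprime_iff_not_dvd).mpr hpm) g 1
  have hJp : jacobiSym x p = -1 := by
    rw [← hg]
    exact jacobiSym.mod_left' (by exact_mod_cast hxp)
  have hJm : jacobiSym x m = 1 := by
    rw [← jacobiSym.one_left m]
    exact jacobiSym.mod_left' (by exact_mod_cast hxm)
  have hJ : jacobiSym x n = -1 := by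
    rw [hnpm, jacobiSym.mul_right' _ (pow_ne_zero e hp.ne_zero) hm, jacobiSym.pow_right, hJp, hJm,
      he.neg_one_pow, mul_one]
  refine ⟨x, ?_, hJ⟩
  by_contra hgcd
  have hJ0 := jacobiSym.eq_zero_iff.mpr ⟨hn0, hgcd⟩
  lia
end

section
/- Let n be an odd composite natural number. Then n is a special Carmichael number (i.e. a^((n-1)/2) ≡ 1 (mod n) for every unit a of Z/nZ) if and only if n is squarefree and (p-1) divides (n-1)/2 for every prime p dividing n. -/
/-- A natural number is an exponent of `(ZMod n)ˣ` iff it is a multiple of the Carmichael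
function of `n`. -/
theorem forall_units_pow_eq_one_iff_carmichael_dvd {n : ℕ} (hn : n ≠ 0) (k : ℕ) :
    (∀ a : (ZMod n)ˣ, (a : ZMod n) ^ k = 1) ↔ ArithmeticFunction.carmichael n ∣ k := by
  rw [ArithmeticFunction.carmichael_eq_exponent hn, Monoid.exponent_dvd_iff_forall_pow_eq_one]
  exact forall_congr' fun a => by rw [← Units.val_pow_eq_pow_val, Units.val_eq_one]

theorem carmichael_prime_of_ne_two {p : ℕ} (hp : p.Prime) (hp2 : p ≠ 2) :
    ArithmeticFunction.carmichael p = p - 1 := by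
  simpa [Nat.totient_prime hp] using
    ArithmeticFunction.carmichael_pow_of_prime_ne_two 1 hp hp2

/-- Korselt-type criterion: an odd composite `n` is a special Carmichael number
(`a ^ ((n-1)/2) ≡ 1 (mod n)` for all units `a`) iff `n` is squarefree and
`(p - 1) ∣ (n - 1)/2` for every prime `p` dividing `n`. -/
theorem stmt_5 (n : ℕ) (hn : 1 < n) (hodd : Odd n) (hcomp : ¬ n.Prime) :
    (∀ a : (ZMod n)ˣ, (a : ZMod n) ^ ((n - 1) / 2) = 1) ↔
      (Squarefree n ∧ ∀ p : ℕ, p.Prime → p ∣ n → (p - 1) ∣ (n - 1) / 2) := by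
  have hn0 : n ≠ 0 := by lia
  have ne_two {p : ℕ} (hpn : p ∣ n) : p ≠ 2 := by
    rintro rfl
    exact hodd.not_two_dvd_nat hpn
  rw [forall_units_pow_eq_one_iff_carmichael_dvd hn0]
  constructor
  · intro h
    refine ⟨?_, fun p hp hpn => ?_⟩
    · rw [Nat.squarefree_iff_prime_squarefree]
      intro p hp hpn
      have hpn' : p ∣ n := (dvd_mul_right p p).trans hpn
      have hc : ArithmeticFunction.carmichael (p ^ 2) = p * (p - 1) := by
        rw [ArithmeticFunction.carmichael_pow_of_prime_ne_two 2 hp (ne_two hpn'),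
          Nat.totient_prime_pow hp two_pos]
        simp
      rw [← sq] at hpn
      have hdvd : p ∣ (n - 1) / 2 :=
        ((Dvd.intro _ hc.symm).trans (ArithmeticFunction.carmichael_dvd hpn)).trans h
      have hdvd' : p ∣ n - 1 :=
        hdvd.trans (Nat.div_dvd_of_dvd (Nat.Odd.sub_odd hodd odd_one).two_dvd)
      exact hp.not_dvd_one (by simpa [Nat.sub_sub_self hn.le] using Nat.dvd_sub hpn' hdvd')
    · rw [← carmichael_prime_of_ne_two hp (ne_two hpn)]
      exact (ArithmeticFunction.carmichael_dvd hpn).trans h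
  · rintro ⟨hsq, h⟩
    have : NeZero n := ⟨hn0⟩
    rw [ArithmeticFunction.carmichael_factorization]
    refine Finset.lcm_dvd fun p hp => ?_
    have hpp := Nat.prime_of_mem_primeFactors hp
    have hpn := Nat.dvd_of_mem_primeFactors hp
    rw [Nat.factorization_eq_one_of_squarefree hsq hpp hpn, pow_one,
      carmichael_prime_of_ne_two hpp (ne_two hpn)]
    exact h p hpp hpn
end

section
/- Let n be an odd composite Carmichael number (so a^(n-1) ≡ 1 (mod n) for all units a of Z/nZ). Then there is no unit b of Z/nZ with b^((n-1)/2) ≡ -1 (mod n) such that the set {a ∈ U(Z/nZ) : a^((n-1)/2) ≡ ±1 (mod n)} has cardinality at least φ(n)/2; equivalently, if {a ∈ U(Z/nZ) : a^((n-1)/2) ≡ 1 or -1 (mod n)} has cardinality at least φ(n)/2, then a^((n-1)/2) ≢ -1 (mod n) for every unit a. -/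
/-- Every prime power dividing a Carmichael number has its totient dividing `n - 1`. -/
lemma totient_prime_pow_dvd_sub_one {n p k : ℕ} (hn : n ≠ 0) (hodd : Odd n) (hp : p.Prime)
    (hk : k ≠ 0) (hcarmichael : ∀ a : (ZMod n)ˣ, a ^ (n - 1) = 1) (hpn : p ^ k ∣ n) :
    (p ^ k).totient ∣ n - 1 := by
  have hp2 : p ≠ 2 := by
    rintro rfl
    exact (Nat.not_even_iff_odd.mpr hodd)
      (even_iff_two_dvd.mpr ((dvd_pow_self 2 hk).trans hpn))
  have h : ArithmeticFunction.carmichael n ∣ n - 1 := by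
    rw [ArithmeticFunction.carmichael_eq_exponent hn]
    exact Monoid.exponent_dvd_of_forall_pow_eq_one hcarmichael
  rw [← ArithmeticFunction.carmichael_pow_of_prime_ne_two k hp hp2]
  exact (ArithmeticFunction.carmichael_dvd hpn).trans h

/-- Odd composite Carmichael numbers are squarefree. -/
lemma squarefree_of_forall_units_pow_sub_one_eq_one {n : ℕ} (hn : 1 < n) (hodd : Odd n)
    (hcarmichael : ∀ a : (ZMod n)ˣ, a ^ (n - 1) = 1) : Squarefree n := by
  rw [Nat.squarefree_iff_prime_squarefree]
  intro p hp hpp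
  have h := totient_prime_pow_dvd_sub_one (by lia) hodd hp two_ne_zero hcarmichael
    (by rwa [pow_two])
  rw [Nat.totient_prime_pow hp two_pos] at h
  have h1 : p ∣ n - 1 := ((dvd_pow_self p one_ne_zero).mul_right _).trans h
  have h2 : p ∣ n := (Dvd.intro _ rfl).trans hpp
  have h3 : p ∣ 1 := by
    have := Nat.dvd_sub h2 h1
    rwa [Nat.sub_sub_self hn.le] at this
  exact hp.one_lt.ne' (Nat.dvd_one.mp h3)

/-- An odd composite Carmichael number is not a product of two primes. -/
lemma not_mul_prime_of_forall_units_pow_sub_one_eq_one {p q : ℕ} (hp : p.Prime) (hq : q.Prime)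
    (hodd : Odd (p * q)) (hcarmichael : ∀ a : (ZMod (p * q))ˣ, a ^ (p * q - 1) = 1)
    (hlt : p < q) : False := by
  have h := totient_prime_pow_dvd_sub_one (mul_pos hp.pos hq.pos).ne' hodd hq one_ne_zero
    hcarmichael (by simp)
  rw [pow_one, Nat.totient_prime hq] at h
  have hp1 := hp.one_lt
  have e : p * q - 1 = p * (q - 1) + (p - 1) := by
    obtain ⟨r, rfl⟩ : ∃ r, q = r + 1 := ⟨q - 1, by lia⟩
    simp only [Nat.add_sub_cancel, mul_add, mul_one]
    lia
  rw [e, Nat.dvd_add_right (Dvd.intro_left _ rfl)] at h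
  have := Nat.le_of_dvd (by lia) h
  lia

/-- An odd composite Carmichael number splits into three pairwise coprime nontrivial factors. -/
lemma exists_three_coprime_factors {n : ℕ} (hn : 1 < n) (hodd : Odd n) (hcomp : ¬ n.Prime)
    (hcarmichael : ∀ a : (ZMod n)ˣ, a ^ (n - 1) = 1) :
    ∃ u v w : ℕ, n = u * (v * w) ∧ 2 < u ∧ 2 < v ∧ 2 < w ∧
      u.Coprime v ∧ u.Coprime w ∧ v.Coprime w := by
  have hsq := squarefree_of_forall_units_pow_sub_one_eq_one hn hodd hcarmichael
  have hp := Nat.minFac_prime hn.ne'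
  obtain ⟨k, hk⟩ := n.minFac_dvd
  generalize n.minFac = p at hp hk
  have hk1 : k ≠ 1 := by
    rintro rfl
    rw [mul_one] at hk
    exact hcomp (hk ▸ hp)
  have hq := Nat.minFac_prime hk1
  obtain ⟨l, hl⟩ := k.minFac_dvd
  generalize k.minFac = q at hq hl
  subst hl hk
  have hc := Nat.coprime_of_squarefree_mul hsq
  have hc' := Nat.coprime_of_squarefree_mul (hsq.of_mul_right)
  have hpq := Nat.Coprime.coprime_mul_right_right hc
  have hl1 : l ≠ 1 := by
    rintro rfl
    rw [mul_one] at *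
    rcases lt_trichotomy p q with h | h | h
    · exact not_mul_prime_of_forall_units_pow_sub_one_eq_one hp hq hodd hcarmichael h
    · subst h
      exact hp.one_lt.ne' ((Nat.coprime_self p).mp hpq)
    · rw [mul_comm] at hodd hcarmichael
      exact not_mul_prime_of_forall_units_pow_sub_one_eq_one hq hp hodd hcarmichael h
  have hodd' := hodd
  rw [Nat.odd_mul, Nat.odd_mul] at hodd'
  obtain ⟨⟨a, ha⟩, ⟨b, hb⟩, ⟨c, hc0⟩⟩ := hodd'
  have := hp.one_lt
  have := hq.one_lt
  exact ⟨p, q, l, rfl, by lia, by lia, by lia, hpq,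
    Nat.Coprime.coprime_mul_left_right hc, hc'⟩

/-- For coprime `u` and `k`, a unit modulo `u * k` can be replaced by one that agrees with it
modulo `u` and is trivial modulo `k`. -/
lemma ZMod.exists_unitsMap_eq_and_unitsMap_eq_one {n u k : ℕ} (hn : n = u * k)
    (h : u.Coprime k) (hu : u ∣ n) (hk : k ∣ n) (b : (ZMod n)ˣ) :
    ∃ x : (ZMod n)ˣ, ZMod.unitsMap hu x = ZMod.unitsMap hu b ∧ ZMod.unitsMap hk x = 1 := by
  subst hn
  let e := ZMod.chineseRemainder h
  have e1 : (RingHom.fst _ _).comp e.toRingHom = ZMod.castHom hu (ZMod u) :=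
    Subsingleton.elim _ _
  have e2 : (RingHom.snd _ _).comp e.toRingHom = ZMod.castHom hk (ZMod k) :=
    Subsingleton.elim _ _
  let y : (ZMod u × ZMod k)ˣ := MulEquiv.prodUnits.symm (ZMod.unitsMap hu b, 1)
  refine ⟨Units.map e.symm.toRingHom.toMonoidHom y, ?_, ?_⟩
  · ext
    rw [ZMod.unitsMap_def, ← e1]
    simp [y]
    exact (DFunLike.congr_fun e1 (b : ZMod (u * k))).symm
  · ext
    rw [ZMod.unitsMap_def, ← e2]
    simp [y]
    rfl

lemma ZMod.units_one_ne_neg_one {u : ℕ} (hu : 2 < u) : (1 : (ZMod u)ˣ) ≠ -1 := by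
  have : Fact (2 < u) := ⟨hu⟩
  intro h
  exact ZMod.neg_one_ne_one (n := u) (by simpa using (congrArg Units.val h).symm)

lemma ZMod.unitsMap_neg_one {n u : ℕ} (h : u ∣ n) : ZMod.unitsMap h (-1) = -1 := by
  ext
  rw [ZMod.unitsMap_def, Units.coe_map]
  simp [-ZMod.castHom_apply]

/-- A unit that is `-1` modulo one divisor and `1` modulo another is not `±1`. -/
lemma ZMod.not_eq_one_or_eq_neg_one {n u w : ℕ} (hu : u ∣ n) (hw : w ∣ n) (hu2 : 2 < u)
    (hw2 : 2 < w) {x : (ZMod n)ˣ} (hxu : ZMod.unitsMap hu x = -1)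
    (hxw : ZMod.unitsMap hw x = 1) : ¬ (x = 1 ∨ x = -1) := by
  rintro (rfl | rfl)
  · exact ZMod.units_one_ne_neg_one hu2 (by rw [← hxu, map_one])
  · exact ZMod.units_one_ne_neg_one hw2 (by rw [← ZMod.unitsMap_neg_one hw, hxw])

/-- The subgroup of elements whose `m`-th power is `1` or `-1`. -/
def powEqOneOrNegOne (M : Type*) [CommGroup M] [HasDistribNeg M] (m : ℕ) : Subgroup M where
  carrier := {a | a ^ m = 1 ∨ a ^ m = -1}
  one_mem' := by simp
  mul_mem' := by
    rintro a b (ha | ha) (hb | hb) <;> simp [mul_pow, ha, hb]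
  inv_mem' := by
    rintro a (ha | ha) <;> simp [ha]

/-- Let `n` be an odd composite Carmichael number. If the set
`{a ∈ U(ℤ/nℤ) : a ^ ((n-1)/2) ≡ ±1 (mod n)}` has cardinality at least
`φ(n)/2`, then no unit `b` satisfies `b ^ ((n-1)/2) ≡ -1 (mod n)`. -/
theorem stmt_9 (n : ℕ) (hn : 1 < n) (hodd : Odd n) (hcomp : ¬ n.Prime)
    (hcarmichael : ∀ a : (ZMod n)ˣ, (a : ZMod n) ^ (n - 1) = 1)
    (hB : n.totient / 2 ≤ Nat.card {a : (ZMod n)ˣ //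
        (a : ZMod n) ^ ((n - 1) / 2) = 1 ∨ (a : ZMod n) ^ ((n - 1) / 2) = -1}) :
    ∀ b : (ZMod n)ˣ, (b : ZMod n) ^ ((n - 1) / 2) ≠ -1 := by
  intro b hb
  have : NeZero n := ⟨by lia⟩
  generalize hm : (n - 1) / 2 = m at hB hb
  have hb' : b ^ m = -1 := by ext; simpa using hb
  obtain ⟨u, v, w, hfac, hu, hv, hw, huv, huw, hvw⟩ :=
    exists_three_coprime_factors hn hodd hcomp fun a => by ext; simpa using hcarmichael a
  have hun : u ∣ n := ⟨_, hfac⟩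
  have hvn : v ∣ n := ⟨u * w, by rw [hfac]; ring⟩
  have hwn : w ∣ n := ⟨u * v, by rw [hfac]; ring⟩
  have hvwn : v * w ∣ n := ⟨u, by rw [hfac]; ring⟩
  have huwn : u * w ∣ n := ⟨v, by rw [hfac]; ring⟩
  obtain ⟨x, hxu, hx⟩ := ZMod.exists_unitsMap_eq_and_unitsMap_eq_one hfac
    (huv.mul_right huw) hun hvwn b
  obtain ⟨y, hyv, hy⟩ := ZMod.exists_unitsMap_eq_and_unitsMap_eq_one
    (show n = v * (u * w) by rw [hfac]; ring) (huv.symm.mul_right hvw) hvn huwn b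
  have restrict {d e : ℕ} (hd : d ∣ e) (he : e ∣ n) (z : (ZMod n)ˣ)
      (hz : ZMod.unitsMap he z = 1) : ZMod.unitsMap (hd.trans he) z = 1 := by
    rw [← ZMod.unitsMap_comp hd he, MonoidHom.comp_apply, hz, map_one]
  have hxw := restrict (Dvd.intro_left _ rfl) hvwn x hx
  have hxv := restrict (Dvd.intro _ rfl) hvwn x hx
  have hyw := restrict (Dvd.intro_left _ rfl) huwn y hy
  have hyu := restrict (Dvd.intro _ rfl) huwn y hy
  let B := powEqOneOrNegOne (ZMod n)ˣ m
  have hxB : x ∉ B := ZMod.not_eq_one_or_eq_neg_one hun hwn hu hw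
    (by rw [map_pow, hxu, ← map_pow, hb', ZMod.unitsMap_neg_one])
    (by rw [map_pow, hxw, one_pow])
  have hyB : y ∉ B := ZMod.not_eq_one_or_eq_neg_one hvn hwn hv hw
    (by rw [map_pow, hyv, ← map_pow, hb', ZMod.unitsMap_neg_one])
    (by rw [map_pow, hyw, one_pow])
  have hxyB : x * y ∉ B := ZMod.not_eq_one_or_eq_neg_one hun hwn hu hw
    (by rw [map_pow, map_mul, hyu, mul_one, hxu, ← map_pow, hb', ZMod.unitsMap_neg_one])
    (by rw [map_pow, map_mul, hxw, hyw, mul_one, one_pow])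
  have hcard : Nat.card {a : (ZMod n)ˣ // (a : ZMod n) ^ m = 1 ∨ (a : ZMod n) ^ m = -1} =
      Nat.card B :=
    Nat.card_congr (Equiv.subtypeEquivRight fun a => by
      change _ ↔ (a ^ m = 1 ∨ a ^ m = -1)
      simp [Units.ext_iff])
  have hindex := B.index_mul_card
  rw [Nat.card_eq_fintype_card (α := (ZMod n)ˣ), ZMod.card_units_eq_totient] at hindex
  have heven : Even n.totient := Nat.totient_even
    (hu.trans_le (Nat.le_of_dvd (by lia) hun))
  have hle : B.index ≤ 2 := by
    rw [hcard] at hB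
    obtain ⟨t, ht⟩ := heven
    have hpos : 0 < Nat.card B := Nat.card_pos
    by_contra! h
    have : 3 * Nat.card B ≤ B.index * Nat.card B := Nat.mul_le_mul_right _ h
    lia
  have hne1 : B.index ≠ 1 := fun h => hxB (Subgroup.index_eq_one.mp h ▸ Subgroup.mem_top x)
  have hne0 : B.index ≠ 0 := Subgroup.FiniteIndex.index_ne_zero
  have h2 : B.index = 2 := by lia
  exact hxyB ((Subgroup.mul_mem_iff_of_index_two h2).mpr (iff_of_false hxB hyB))
end
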